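/- There is an absolute constant c > 0 such that the following holds. Assume the deterministic events ‖W‖ ≤ √(nd)+√m+√(2γ log n) and max_{1≤i≤n} ‖W_i A^T‖ ≤ (2√d+√(2γ log n))‖A‖ hold, let ε = 1/(32κ²√d) and ξ = 6, and assume σ ≤ c·(σ_min(A)/κ²)·√n/(√d·(√(nd)+√m+√(2γ n log n))). Then for any X, Y ∈ N_ε ∩ N_{ξ,∞}, d_F(T(X), T(Y)) ≤ (κ²/(1−ε²d))·(2ε√d + 3σ‖W‖/(√n‖A‖))·d_F(X,Y) ≤ (1/2)·d_F(X,Y). -/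

import Mathlib

open MeasureTheory Matrix Filter

namespace GOPP

/-- Frobenius norm of a real matrix. -/
noncomputable def frob {α β : Type*} [Fintype α] [Fintype β] (X : Matrix α β ℝ) : ℝ :=
  Real.sqrt (∑ i, ∑ j, X i j ^ 2)

/-- Euclidean norm of a vector. -/
noncomputable def vnorm {β : Type*} [Fintype β] (v : β → ℝ) : ℝ :=
  Real.sqrt (∑ j, v j ^ 2)

/-- Operator (spectral) norm: the supremum of ‖Xu‖ over unit vectors u. -/
noncomputable def opNorm {α β : Type*} [Fintype α] [Fintype β] (X : Matrix α β ℝ) : ℝ :=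
  sSup {r : ℝ | ∃ u : β → ℝ, vnorm u = 1 ∧ r = vnorm (X.mulVec u)}

/-- Smallest singular value: the infimum of ‖uᵀX‖ over unit vectors u (for a d×m matrix
with d ≤ m this is the d-th largest singular value; for square matrices it is σ_min). -/
noncomputable def sigmaMin {α β : Type*} [Fintype α] [Fintype β] (X : Matrix α β ℝ) : ℝ :=
  sInf {r : ℝ | ∃ u : α → ℝ, vnorm u = 1 ∧ r = vnorm (Matrix.vecMul u X)}

/-- Condition number κ = σ_max/σ_min. -/
noncomputable def kappa {d m : ℕ} (A : Matrix (Fin d) (Fin m) ℝ) : ℝ :=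
  opNorm A / sigmaMin A

/-- Q is an orthogonal matrix. -/
def IsOrth {d : ℕ} (Q : Matrix (Fin d) (Fin d) ℝ) : Prop :=
  Qᵀ * Q = 1 ∧ Q * Qᵀ = 1

/-- Nuclear norm, via the dual characterization ‖M‖_* = max_{Q ∈ O(d)} ⟨Q, M⟩. -/
noncomputable def nuclearNorm {d : ℕ} (M : Matrix (Fin d) (Fin d) ℝ) : ℝ :=
  sSup {r : ℝ | ∃ Q : Matrix (Fin d) (Fin d) ℝ, IsOrth Q ∧ r = Matrix.trace (Qᵀ * M)}

/-- The i-th d×k block of an (nd)×k block matrix. -/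
def blk {n d k : ℕ} (S : Matrix (Fin n × Fin d) (Fin k) ℝ) (i : Fin n) :
    Matrix (Fin d) (Fin k) ℝ :=
  Matrix.of fun a b => S (i, a) b

/-- The i-th diagonal d×d block of an (nd)×(nd) matrix. -/
def dblk {n d : ℕ} (G : Matrix (Fin n × Fin d) (Fin n × Fin d) ℝ) (i : Fin n) :
    Matrix (Fin d) (Fin d) ℝ :=
  Matrix.of fun a b => G (i, a) (i, b)

/-- S ∈ O(d)^{⊗n}: each of the n d×d blocks of S is orthogonal. -/
def OrthBlocks {n d : ℕ} (S : Matrix (Fin n × Fin d) (Fin d) ℝ) : Prop :=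
  ∀ i, IsOrth (blk S i)

/-- Z ∈ ℝ^{nd×d}: the vertical stack of n copies of I_d. -/
def ZStack (n d : ℕ) : Matrix (Fin n × Fin d) (Fin d) ℝ :=
  Matrix.of fun p j => if p.2 = j then 1 else 0

/-- Vertical stack of n given d×k matrices. -/
def stack {n d k : ℕ} (B : Fin n → Matrix (Fin d) (Fin k) ℝ) :
    Matrix (Fin n × Fin d) (Fin k) ℝ :=
  Matrix.of fun p b => B p.1 p.2 b

/-- d_F(X,Y) = min_{Q ∈ O(d)} ‖X − YQ‖_F. -/
noncomputable def dF {n d : ℕ} (X Y : Matrix (Fin n × Fin d) (Fin d) ℝ) : ℝ :=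
  sInf {r : ℝ | ∃ Q, IsOrth Q ∧ r = frob (X - Y * Q)}

/-- R is a polar factor P(X) of X: an orthogonal global minimizer of ‖X − Q‖_F over O(d). -/
def IsPolar {d : ℕ} (X R : Matrix (Fin d) (Fin d) ℝ) : Prop :=
  IsOrth R ∧ ∀ Q : Matrix (Fin d) (Fin d) ℝ, IsOrth Q → frob (X - R) ≤ frob (X - Q)

/-- S = P_n(X): blockwise polar factor. -/
def IsPolarBlocks {n d : ℕ} (X S : Matrix (Fin n × Fin d) (Fin d) ℝ) : Prop :=
  ∀ i, IsPolar (blk X i) (blk S i)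

/-- U collects (an orthonormal basis of the span of) the top d left singular vectors of D:
U has orthonormal columns and maximizes the Ky Fan quantity trace(Uᵀ(DDᵀ)U). -/
def IsTopSingVecs {N : Type*} [Fintype N] {d m : ℕ} (D : Matrix N (Fin m) ℝ)
    (U : Matrix N (Fin d) ℝ) : Prop :=
  Uᵀ * U = 1 ∧ ∀ Q : Matrix N (Fin d) ℝ, Qᵀ * Q = 1 →
    Matrix.trace (Qᵀ * (D * Dᵀ) * Q) ≤ Matrix.trace (Uᵀ * (D * Dᵀ) * U)

/-- (U, S, V) is a top-d singular triple of D: orthonormal U, V, diagonal nonnegative S,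
DV = US, DᵀU = VS, and U spans a top-d left singular subspace. -/
def IsSVDTriple {N : Type*} [Fintype N] {d m : ℕ} (D : Matrix N (Fin m) ℝ)
    (U : Matrix N (Fin d) ℝ) (S : Matrix (Fin d) (Fin d) ℝ)
    (V : Matrix (Fin m) (Fin d) ℝ) : Prop :=
  Vᵀ * V = 1 ∧ (∀ a b, a ≠ b → S a b = 0) ∧ (∀ a, 0 ≤ S a a) ∧
    D * V = U * S ∧ Dᵀ * U = V * S ∧ IsTopSingVecs D U

/-- The generalized power method sequence with spectral initialization, run on the data
matrix D (so with C = DDᵀ): S⁰ = P_n(U) for top singular vectors U of D, and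
S^{t+1} = P_n(C Sᵗ). -/
def IsGPM {n d m : ℕ} (D : Matrix (Fin n × Fin d) (Fin m) ℝ)
    (S : ℕ → Matrix (Fin n × Fin d) (Fin d) ℝ) : Prop :=
  (∃ U, IsTopSingVecs D U ∧ IsPolarBlocks U (S 0)) ∧
    ∀ t, IsPolarBlocks (D * Dᵀ * S t) (S (t + 1))

/-- W^(i): W with its i-th block row replaced by 0. -/
def mask {n d m : ℕ} (W : Matrix (Fin n × Fin d) (Fin m) ℝ) (i : Fin n) :
    Matrix (Fin n × Fin d) (Fin m) ℝ :=
  Matrix.of fun p b => if p.1 = i then 0 else W p b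

/-- The noise matrix Δ = WAᵀZᵀ + ZAWᵀ + σWWᵀ. -/
noncomputable def delta {n d m : ℕ} (A : Matrix (Fin d) (Fin m) ℝ)
    (W : Matrix (Fin n × Fin d) (Fin m) ℝ) (σ : ℝ) :
    Matrix (Fin n × Fin d) (Fin n × Fin d) ℝ :=
  W * Aᵀ * (ZStack n d)ᵀ + ZStack n d * A * Wᵀ + σ • (W * Wᵀ)

/-- The i-th block column Δ_i = WAᵀ + ZAW_iᵀ + σWW_iᵀ of Δ. -/
noncomputable def deltaCol {n d m : ℕ} (A : Matrix (Fin d) (Fin m) ℝ)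
    (W : Matrix (Fin n × Fin d) (Fin m) ℝ) (σ : ℝ) (i : Fin n) :
    Matrix (Fin n × Fin d) (Fin d) ℝ :=
  W * Aᵀ + ZStack n d * A * (blk W i)ᵀ + σ • (W * (blk W i)ᵀ)

/-- The operator L S = C S/(n‖A‖²) with C = ZAAᵀZᵀ + σΔ. -/
noncomputable def Lop {n d m : ℕ} (A : Matrix (Fin d) (Fin m) ℝ)
    (W : Matrix (Fin n × Fin d) (Fin m) ℝ) (σ : ℝ)
    (S : Matrix (Fin n × Fin d) (Fin d) ℝ) : Matrix (Fin n × Fin d) (Fin d) ℝ :=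
  ((n : ℝ) * opNorm A ^ 2)⁻¹ •
    ((ZStack n d * A * Aᵀ * (ZStack n d)ᵀ + σ • delta A W σ) * S)

/-- √(nd) + √m + √(2γ n log n). -/
noncomputable def bnd1 (n d m : ℕ) (γ : ℝ) : ℝ :=
  Real.sqrt ((n : ℝ) * d) + Real.sqrt (m : ℝ) + Real.sqrt (2 * γ * n * Real.log n)

/-- √(nd) + √m + √(2γ log n). -/
noncomputable def bnd2 (n d m : ℕ) (γ : ℝ) : ℝ :=
  Real.sqrt ((n : ℝ) * d) + Real.sqrt (m : ℝ) + Real.sqrt (2 * γ * Real.log n)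

/-- The basin of attraction N_ε. -/
def memNeps {n d : ℕ} (ε : ℝ) (S : Matrix (Fin n × Fin d) (Fin d) ℝ) : Prop :=
  OrthBlocks S ∧ dF S (ZStack n d) ≤ ε * Real.sqrt ((n : ℝ) * d)

/-- The basin of attraction N_{ξ,∞}. -/
def memNxi {n d m : ℕ} (W : Matrix (Fin n × Fin d) (Fin m) ℝ) (γ ξ : ℝ)
    (S : Matrix (Fin n × Fin d) (Fin d) ℝ) : Prop :=
  OrthBlocks S ∧ ∀ i, frob (blk W i * Wᵀ * S) ≤ ξ * Real.sqrt (d : ℝ) * bnd1 n d m γ ^ 2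

/-- The distribution of a matrix with i.i.d. standard Gaussian N(0,1) entries. -/
noncomputable def stdGaussian (ι κ : Type*) [Fintype ι] [Fintype κ] :
    Measure (ι → κ → ℝ) :=
  Measure.pi fun _ : ι => Measure.pi fun _ : κ => ProbabilityTheory.gaussianReal 0 1


theorem vnorm_eq_norm {β : Type*} [Fintype β] (v : β → ℝ) :
    vnorm v = ‖WithLp.toLp 2 v‖ := by
  simp [vnorm, EuclideanSpace.norm_eq]

theorem vnorm_nonneg {β : Type*} [Fintype β] (v : β → ℝ) : 0 ≤ vnorm v := Real.sqrt_nonneg _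

theorem vnorm_sq {β : Type*} [Fintype β] (v : β → ℝ) : vnorm v ^ 2 = v ⬝ᵥ v := by
  rw [vnorm, Real.sq_sqrt (Finset.sum_nonneg fun _ _ => sq_nonneg _)]
  simp [dotProduct, sq]

theorem vnorm_add_le {β : Type*} [Fintype β] (u v : β → ℝ) :
    vnorm (u + v) ≤ vnorm u + vnorm v := by
  simpa [vnorm_eq_norm] using norm_add_le (WithLp.toLp 2 u) (WithLp.toLp 2 v)

theorem vnorm_smul {β : Type*} [Fintype β] (c : ℝ) (v : β → ℝ) :
    vnorm (c • v) = |c| * vnorm v := by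
  simpa [vnorm_eq_norm] using norm_smul c (WithLp.toLp 2 v)

theorem vnorm_sub_le {β : Type*} [Fintype β] (u v : β → ℝ) :
    vnorm (u - v) ≤ vnorm u + vnorm v := by
  simpa [vnorm_eq_norm] using norm_sub_le (WithLp.toLp 2 u) (WithLp.toLp 2 v)

theorem dotProduct_le_vnorm {β : Type*} [Fintype β] (u v : β → ℝ) :
    u ⬝ᵥ v ≤ vnorm u * vnorm v := by
  have := real_inner_le_norm (WithLp.toLp 2 v) (WithLp.toLp 2 u)
  rw [← vnorm_eq_norm, ← vnorm_eq_norm, mul_comm] at this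
  simpa [PiLp.inner_apply, dotProduct] using this

theorem vnorm_eq_zero {β : Type*} [Fintype β] {v : β → ℝ} : vnorm v = 0 ↔ v = 0 := by
  simp [vnorm_eq_norm]

section Frobenius

variable {α β μ : Type*} [Fintype α] [Fintype β] [Fintype μ]

theorem frob_eq_vnorm (X : Matrix α β ℝ) : frob X = vnorm fun p : α × β => X p.1 p.2 := by
  simp [frob, vnorm, Fintype.sum_prod_type]

theorem frob_nonneg (X : Matrix α β ℝ) : 0 ≤ frob X := Real.sqrt_nonneg _

theorem frob_add_le (X Y : Matrix α β ℝ) : frob (X + Y) ≤ frob X + frob Y := by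
  simp only [frob_eq_vnorm]
  exact vnorm_add_le _ _

theorem frob_sub_le (X Y : Matrix α β ℝ) : frob (X - Y) ≤ frob X + frob Y := by
  simp only [frob_eq_vnorm]
  exact vnorm_sub_le _ _

theorem frob_smul (c : ℝ) (X : Matrix α β ℝ) : frob (c • X) = |c| * frob X := by
  simp only [frob_eq_vnorm]
  exact vnorm_smul _ _

theorem frob_sub_rev (X Y : Matrix α β ℝ) : frob (X - Y) = frob (Y - X) := by
  rw [← neg_sub, ← neg_one_smul ℝ, frob_smul]
  simp

theorem frob_sq (X : Matrix α β ℝ) : frob X ^ 2 = ∑ i, ∑ j, X i j ^ 2 :=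
  Real.sq_sqrt (Finset.sum_nonneg fun _ _ => Finset.sum_nonneg fun _ _ => sq_nonneg _)

theorem frob_transpose (X : Matrix α β ℝ) : frob Xᵀ = frob X := by
  rw [frob, frob, Finset.sum_comm]
  rfl

theorem trace_transpose_mul (X Y : Matrix α β ℝ) :
    trace (Xᵀ * Y) = ∑ i, ∑ j, X i j * Y i j := by
  simp only [trace, diag, mul_apply, transpose_apply]
  exact Finset.sum_comm

theorem frob_sq_eq_trace (X : Matrix α β ℝ) : frob X ^ 2 = trace (Xᵀ * X) := by
  rw [frob_sq, trace_transpose_mul]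
  simp only [sq]

theorem trace_transpose_mul_le (X Y : Matrix α β ℝ) : trace (Xᵀ * Y) ≤ frob X * frob Y := by
  rw [trace_transpose_mul, frob_eq_vnorm, frob_eq_vnorm]
  simpa [dotProduct, Fintype.sum_prod_type] using
    dotProduct_le_vnorm (fun p : α × β => X p.1 p.2) fun p => Y p.1 p.2

theorem frob_sub_sq (X Y : Matrix α β ℝ) :
    frob (X - Y) ^ 2 = frob X ^ 2 - 2 * trace (Yᵀ * X) + frob Y ^ 2 := by
  simp only [frob_sq, trace_transpose_mul, Finset.mul_sum, ← Finset.sum_sub_distrib,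
    ← Finset.sum_add_distrib, Matrix.sub_apply]
  exact Finset.sum_congr rfl fun i _ => Finset.sum_congr rfl fun j _ => by ring

theorem frob_sq_eq_sum_col (X : Matrix α β ℝ) : frob X ^ 2 = ∑ j, vnorm (X.col j) ^ 2 := by
  rw [frob_sq, Finset.sum_comm]
  simp only [vnorm_sq, dotProduct, ← sq, Matrix.col, transpose_apply]

theorem frob_sq_eq_sum_row (X : Matrix α β ℝ) : frob X ^ 2 = ∑ i, vnorm (X i) ^ 2 := by
  simp only [frob_sq, vnorm_sq, dotProduct, ← sq]

theorem vnorm_mulVec_le_frob (X : Matrix α β ℝ) (v : β → ℝ) :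
    vnorm (X *ᵥ v) ≤ frob X * vnorm v := by
  refine abs_le_of_sq_le_sq' ?_ (mul_nonneg (frob_nonneg X) (vnorm_nonneg v)) |>.2
  rw [mul_pow, frob_sq_eq_sum_row, vnorm_sq, Finset.sum_mul]
  refine Finset.sum_le_sum fun i _ => ?_
  rw [← sq, ← mul_pow]
  refine sq_le_sq.2 (abs_le_abs (dotProduct_le_vnorm _ _) ?_)
  have := dotProduct_le_vnorm (-X i) v
  have h : vnorm (-X i) = vnorm (X i) := by simpa using vnorm_smul (-1) (X i)
  rwa [neg_dotProduct, h] at this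

theorem vnorm_mulVec_le (X : Matrix α β ℝ) (v : β → ℝ) :
    vnorm (X *ᵥ v) ≤ opNorm X * vnorm v := by
  rcases eq_or_ne (vnorm v) 0 with h | h
  · simp [vnorm_eq_zero.1 h, vnorm]
  have hpos := lt_of_le_of_ne (vnorm_nonneg v) h.symm
  have key : vnorm (X *ᵥ ((vnorm v)⁻¹ • v)) ≤ opNorm X := by
    refine le_csSup ⟨frob X, ?_⟩ ⟨(vnorm v)⁻¹ • v, ?_, rfl⟩
    · rintro r ⟨u, hu, rfl⟩
      simpa [hu] using vnorm_mulVec_le_frob X u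
    · rw [vnorm_smul, abs_inv, abs_of_pos hpos, inv_mul_cancel₀ h]
  rwa [mulVec_smul, vnorm_smul, abs_inv, abs_of_pos hpos, inv_mul_le_iff₀ hpos, mul_comm] at key

theorem opNorm_nonneg (X : Matrix α β ℝ) : 0 ≤ opNorm X :=
  Real.sSup_nonneg (by rintro r ⟨u, -, rfl⟩; exact vnorm_nonneg _)

theorem opNorm_le {X : Matrix α β ℝ} {c : ℝ} (hc : 0 ≤ c)
    (h : ∀ v, vnorm (X *ᵥ v) ≤ c * vnorm v) : opNorm X ≤ c :=
  Real.sSup_le (by rintro r ⟨u, hu, rfl⟩; simpa [hu] using h u) hc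

theorem opNorm_le_frob (X : Matrix α β ℝ) : opNorm X ≤ frob X :=
  opNorm_le (frob_nonneg X) (vnorm_mulVec_le_frob X)

theorem vnorm_transpose_mulVec_sq (X : Matrix α β ℝ) (v : α → ℝ) :
    vnorm (Xᵀ *ᵥ v) ^ 2 = v ⬝ᵥ (X *ᵥ (Xᵀ *ᵥ v)) := by
  rw [vnorm_sq, dotProduct_mulVec v X, ← mulVec_transpose]

theorem opNorm_transpose_le (X : Matrix α β ℝ) : opNorm Xᵀ ≤ opNorm X := by
  refine opNorm_le (opNorm_nonneg X) fun v => ?_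
  have h1 := vnorm_transpose_mulVec_sq X v
  have h2 := dotProduct_le_vnorm v (X *ᵥ (Xᵀ *ᵥ v))
  have h3 := mul_le_mul_of_nonneg_left (vnorm_mulVec_le X (Xᵀ *ᵥ v)) (vnorm_nonneg v)
  rcases (vnorm_nonneg (Xᵀ *ᵥ v)).eq_or_lt with h | h
  · rw [← h]
    exact mul_nonneg (opNorm_nonneg X) (vnorm_nonneg v)
  · refine le_of_mul_le_mul_right ?_ h
    linarith

theorem opNorm_transpose_le_frob (X : Matrix α β ℝ) : opNorm Xᵀ ≤ frob X :=
  (opNorm_transpose_le X).trans (opNorm_le_frob X)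

theorem frob_mul_le (X : Matrix α β ℝ) (Y : Matrix β μ ℝ) :
    frob (X * Y) ≤ opNorm X * frob Y := by
  refine abs_le_of_sq_le_sq' ?_ (mul_nonneg (opNorm_nonneg X) (frob_nonneg Y)) |>.2
  rw [mul_pow, frob_sq_eq_sum_col, frob_sq_eq_sum_col, Finset.mul_sum]
  refine Finset.sum_le_sum fun j _ => ?_
  rw [← mul_pow]
  exact pow_le_pow_left₀ (vnorm_nonneg _) (vnorm_mulVec_le X (Y.col j)) 2

theorem frob_mul_le_mul {X : Matrix α β ℝ} {Y : Matrix β μ ℝ} {b c : ℝ} (hX : opNorm X ≤ b)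
    (hY : frob Y ≤ c) : frob (X * Y) ≤ b * c :=
  (frob_mul_le X Y).trans (mul_le_mul hX hY (frob_nonneg _) ((opNorm_nonneg _).trans hX))

end Frobenius

section Orthogonal

theorem IsOrth.one {d : ℕ} : IsOrth (1 : Matrix (Fin d) (Fin d) ℝ) := by simp [IsOrth]

theorem IsOrth.transpose {d : ℕ} {Q : Matrix (Fin d) (Fin d) ℝ} (hQ : IsOrth Q) : IsOrth Qᵀ :=
  ⟨by simpa using hQ.2, by simpa using hQ.1⟩

theorem IsOrth.mul {d : ℕ} {Q R : Matrix (Fin d) (Fin d) ℝ} (hQ : IsOrth Q) (hR : IsOrth R) :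
    IsOrth (Q * R) := by
  constructor
  · rw [transpose_mul, Matrix.mul_assoc, ← Matrix.mul_assoc Qᵀ, hQ.1, Matrix.one_mul, hR.1]
  · rw [transpose_mul, Matrix.mul_assoc, ← Matrix.mul_assoc R, hR.2, Matrix.one_mul, hQ.2]

theorem IsOrth.frob_mul {α : Type*} [Fintype α] {d : ℕ} {Q : Matrix (Fin d) (Fin d) ℝ}
    (hQ : IsOrth Q) (X : Matrix α (Fin d) ℝ) : frob (X * Q) = frob X := by
  rw [← sq_eq_sq₀ (frob_nonneg _) (frob_nonneg _), frob_sq_eq_trace, frob_sq_eq_trace,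
    transpose_mul, ← Matrix.mul_assoc, trace_mul_comm, ← Matrix.mul_assoc, ← Matrix.mul_assoc,
    hQ.2, Matrix.one_mul]

theorem IsOrth.mul_frob {α : Type*} [Fintype α] {d : ℕ} {Q : Matrix (Fin d) (Fin d) ℝ}
    (hQ : IsOrth Q) (X : Matrix (Fin d) α ℝ) : frob (Q * X) = frob X := by
  rw [← frob_transpose, transpose_mul, hQ.transpose.frob_mul, frob_transpose]

theorem vnorm_mulVec_of_transpose_mul {α β : Type*} [Fintype α] [Fintype β] [DecidableEq β]
    {S : Matrix α β ℝ} {c : ℝ} (hS : Sᵀ * S = c • 1) (v : β → ℝ) :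
    vnorm (S *ᵥ v) = √c * vnorm v := by
  rcases (vnorm_nonneg v).eq_or_lt with h | h
  · simp [vnorm_eq_zero.1 h.symm, vnorm]
  have key : vnorm (S *ᵥ v) ^ 2 = c * vnorm v ^ 2 := by
    rw [vnorm_sq, vnorm_sq, dotProduct_mulVec, ← mulVec_transpose, mulVec_mulVec, hS, smul_mulVec,
      one_mulVec, smul_dotProduct, smul_eq_mul]
  have hc : 0 ≤ c := by
    by_contra! hc
    nlinarith [sq_nonneg (vnorm (S *ᵥ v)), mul_pos_of_neg_of_neg hc (neg_neg_of_pos (pow_pos h 2))]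
  rw [← sq_eq_sq₀ (vnorm_nonneg _) (by positivity), key, mul_pow, Real.sq_sqrt hc]

theorem IsOrth.vnorm_mulVec {d : ℕ} {Q : Matrix (Fin d) (Fin d) ℝ}
    (hQ : IsOrth Q) (v : Fin d → ℝ) : vnorm (Q *ᵥ v) = vnorm v := by
  simpa using vnorm_mulVec_of_transpose_mul (c := 1) (by simpa using hQ.1) v

/-- Polar decomposition of a square matrix whose singular values are at least `δ`. -/
theorem exists_polar_decomposition {d : ℕ} {X : Matrix (Fin d) (Fin d) ℝ} {δ : ℝ} (hδ : 0 < δ)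
    (hX : ∀ v, δ * vnorm v ≤ vnorm (X *ᵥ v)) :
    ∃ Q S : Matrix (Fin d) (Fin d) ℝ, IsOrth Q ∧ Sᵀ = S ∧ X = Q * S ∧
      ∀ v, δ * vnorm v ^ 2 ≤ v ⬝ᵥ (S *ᵥ v) := by
  have hH : (Xᵀ * X).IsHermitian := by
    simpa [conjTranspose_eq_transpose_of_trivial] using isHermitian_conjTranspose_mul_self X
  set U : Matrix (Fin d) (Fin d) ℝ := hH.eigenvectorUnitary.1 with hU
  set l := hH.eigenvalues with hl
  have hUO : IsOrth U :=
    ⟨by simpa [star_eq_conjTranspose, conjTranspose_eq_transpose_of_trivial] using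
        Unitary.coe_star_mul_self hH.eigenvectorUnitary,
      by simpa [star_eq_conjTranspose, conjTranspose_eq_transpose_of_trivial] using
        Unitary.coe_mul_star_self hH.eigenvectorUnitary⟩
  have hspec : Uᵀ * (Xᵀ * X) * U = diagonal l := by
    have := hH.conjStarAlgAut_star_eigenvectorUnitary
    rw [Unitary.conjStarAlgAut_star_apply] at this
    simpa [star_eq_conjTranspose, conjTranspose_eq_transpose_of_trivial, Function.comp_def]
      using this
  have hle : ∀ i, δ ^ 2 ≤ l i := by
    intro i
    have h1 : l i = vnorm (X *ᵥ U.col i) ^ 2 := by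
      have h2 := congrFun (congrFun hspec i) i
      rw [diagonal_apply_eq, show Uᵀ * (Xᵀ * X) * U = (X * U)ᵀ * (X * U) by
        simp only [transpose_mul, Matrix.mul_assoc]] at h2
      rw [← h2, vnorm_sq]
      rfl
    have h3 : vnorm (U.col i) ^ 2 = 1 := by
      rw [vnorm_sq]
      exact (congrFun (congrFun hUO.1 i) i).trans (one_apply_eq i)
    have h4 := hX (U.col i)
    rw [(pow_eq_one_iff_of_nonneg (vnorm_nonneg _) two_ne_zero).1 h3, mul_one] at h4
    rw [h1]
    exact pow_le_pow_left₀ hδ.le h4 2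
  have hsq : ∀ i, √(l i) * √(l i) = l i := fun i =>
    Real.mul_self_sqrt ((sq_nonneg δ).trans (hle i))
  have hne : ∀ i, √(l i) ≠ 0 := fun i =>
    (Real.sqrt_pos.2 (lt_of_lt_of_le (by positivity) (hle i))).ne'
  set D : Matrix (Fin d) (Fin d) ℝ := diagonal fun i => √(l i) with hD
  set E : Matrix (Fin d) (Fin d) ℝ := diagonal fun i => (√(l i))⁻¹ with hE
  have hED : E * D = 1 := by simp [hD, hE, diagonal_mul_diagonal, hne]
  have hEl : E * diagonal l * E = 1 := by
    rw [hE, diagonal_mul_diagonal, diagonal_mul_diagonal, ← diagonal_one]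
    congr 1
    ext i
    field_simp [hne i]
    rw [sq, hsq i]
  have hQ : (X * (U * E))ᵀ * (X * (U * E)) = 1 := by
    calc (X * (U * E))ᵀ * (X * (U * E)) = E * (Uᵀ * (Xᵀ * X) * U) * E := by
          simp [transpose_mul, Matrix.mul_assoc, hE]
      _ = 1 := by rw [hspec, hEl]
  have hQ' : IsOrth (X * (U * E)) := ⟨hQ, mul_eq_one_comm.1 hQ⟩
  refine ⟨X * (U * E) * Uᵀ, U * D * Uᵀ, hQ'.mul hUO.transpose, ?_, ?_, ?_⟩
  · simp [transpose_mul, Matrix.mul_assoc, hD]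
  · calc X = X * (U * ((E * D) * Uᵀ)) := by rw [hED, Matrix.one_mul, hUO.2, Matrix.mul_one]
      _ = X * (U * (E * ((Uᵀ * U) * (D * Uᵀ)))) := by
          rw [hUO.1, Matrix.one_mul, Matrix.mul_assoc E]
      _ = _ := by simp only [Matrix.mul_assoc]
  · intro v
    have h1 : v ⬝ᵥ ((U * D * Uᵀ) *ᵥ v) = ∑ i, √(l i) * (Uᵀ *ᵥ v) i ^ 2 := by
      rw [← mulVec_mulVec, ← mulVec_mulVec, dotProduct_mulVec, ← mulVec_transpose, dotProduct]
      refine Finset.sum_congr rfl fun i _ => ?_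
      rw [hD, mulVec_diagonal]
      ring
    rw [h1, ← hUO.transpose.vnorm_mulVec v, vnorm_sq, dotProduct, Finset.mul_sum]
    refine Finset.sum_le_sum fun i _ => ?_
    rw [← sq]
    exact mul_le_mul_of_nonneg_right (Real.le_sqrt_of_sq_le (hle i)) (sq_nonneg _)

theorem trace_mul_mul_transpose_ge {d : ℕ} {S : Matrix (Fin d) (Fin d) ℝ} {δ : ℝ}
    (hS : ∀ v, δ * vnorm v ^ 2 ≤ v ⬝ᵥ (S *ᵥ v)) (E : Matrix (Fin d) (Fin d) ℝ) :
    δ * frob E ^ 2 ≤ trace (E * S * Eᵀ) := by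
  rw [frob_sq_eq_sum_row, Finset.mul_sum]
  refine Finset.sum_le_sum fun i _ => (hS (E i)).trans_eq ?_
  rw [Matrix.mul_assoc]
  simp [mul_apply, dotProduct, mulVec]

/-- The orthogonal polar factor `Q` of `Q * S` strictly maximizes `V ↦ ⟨V, Q * S⟩`. -/
theorem trace_polar_gap {d : ℕ} {Q V S : Matrix (Fin d) (Fin d) ℝ} {δ : ℝ}
    (hQ : IsOrth Q) (hV : IsOrth V) (hS : Sᵀ = S)
    (hS' : ∀ v, δ * vnorm v ^ 2 ≤ v ⬝ᵥ (S *ᵥ v)) :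
    trace (Vᵀ * (Q * S)) + δ / 2 * frob (Q - V) ^ 2 ≤ trace (Qᵀ * (Q * S)) := by
  have h := trace_mul_mul_transpose_ge hS' (Q - V)
  have e1 : trace (Q * S * Qᵀ) = trace (Qᵀ * (Q * S)) := trace_mul_comm _ _
  have e2 : trace (V * S * Vᵀ) = trace (Qᵀ * (Q * S)) := by
    rw [trace_mul_comm, ← Matrix.mul_assoc, ← Matrix.mul_assoc, hV.1, hQ.1]
  have e3 : trace (Q * S * Vᵀ) = trace (Vᵀ * (Q * S)) := trace_mul_comm _ _
  have e4 : trace (V * S * Qᵀ) = trace (Vᵀ * (Q * S)) := by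
    rw [← trace_transpose, transpose_mul, transpose_mul, hS, transpose_transpose,
      ← Matrix.mul_assoc, e3]
  simp only [Matrix.sub_mul, transpose_sub, Matrix.mul_sub, trace_sub, e1, e2, e3, e4] at h
  linarith

theorem IsOrth.frob_sq {d : ℕ} {Q : Matrix (Fin d) (Fin d) ℝ} (hQ : IsOrth Q) :
    frob Q ^ 2 = d := by
  rw [frob_sq_eq_trace, hQ.1, trace_one, Fintype.card_fin]

theorem IsPolar.trace_le {d : ℕ} {X R Q : Matrix (Fin d) (Fin d) ℝ} (h : IsPolar X R)
    (hQ : IsOrth Q) : trace (Qᵀ * X) ≤ trace (Rᵀ * X) := by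
  have := pow_le_pow_left₀ (frob_nonneg _) (h.2 Q hQ) 2
  rw [frob_sub_sq, frob_sub_sq, hQ.frob_sq, h.1.frob_sq] at this
  linarith

/-- The polar factor of a matrix with singular values at least `δ` maximizes the linear functional
`⟨·, X⟩` over the orthogonal group with a quadratic gap. -/
theorem IsPolar.trace_gap {d : ℕ} {X R V : Matrix (Fin d) (Fin d) ℝ} {δ : ℝ} (h : IsPolar X R)
    (hδ : 0 < δ) (hX : ∀ v, δ * vnorm v ≤ vnorm (X *ᵥ v)) (hV : IsOrth V) :
    trace (Vᵀ * X) + δ / 2 * frob (R - V) ^ 2 ≤ trace (Rᵀ * X) := by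
  obtain ⟨Q, S, hQ, hS, rfl, hS'⟩ := exists_polar_decomposition hδ hX
  have h1 := h.trace_le hQ
  have h2 := trace_polar_gap hQ h.1 hS hS'
  have h3 : frob (Q - R) ^ 2 = 0 := by
    refine le_antisymm ?_ (sq_nonneg _)
    by_contra! hc
    linarith [mul_pos (half_pos hδ) hc]
  have h4 : Q = R := by
    rw [frob_eq_vnorm, sq_eq_zero_iff, vnorm_eq_zero] at h3
    ext i j
    simpa [sub_eq_zero] using congrFun h3 (i, j)
  rw [← h4]
  exact trace_polar_gap hQ hV hS hS'

theorem IsPolar.frob_sub_le {d : ℕ} {X X' R R' : Matrix (Fin d) (Fin d) ℝ} {δ : ℝ}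
    (h : IsPolar X R) (h' : IsPolar X' R') (hδ : 0 < δ)
    (hX : ∀ v, δ * vnorm v ≤ vnorm (X *ᵥ v)) (hX' : ∀ v, δ * vnorm v ≤ vnorm (X' *ᵥ v)) :
    δ * frob (R - R') ≤ frob (X - X') := by
  have h1 := h.trace_gap hδ hX h'.1
  have h2 := h'.trace_gap hδ hX' h.1
  have h4 := trace_transpose_mul_le (R - R') (X - X')
  simp only [transpose_sub, Matrix.sub_mul, Matrix.mul_sub, trace_sub] at h4
  rw [frob_sub_rev] at h2
  rcases (frob_nonneg (R - R')).eq_or_lt with h5 | h5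
  · rw [← h5, mul_zero]
    exact frob_nonneg _
  · refine le_of_mul_le_mul_left ?_ h5
    linarith

theorem IsPolar.mul_isOrth {d : ℕ} {X R Q : Matrix (Fin d) (Fin d) ℝ} (h : IsPolar X R)
    (hQ : IsOrth Q) : IsPolar (X * Q) (R * Q) := by
  refine ⟨h.1.mul hQ, fun V hV => ?_⟩
  have := h.2 (V * Qᵀ) (hV.mul hQ.transpose)
  rwa [← hQ.frob_mul, ← hQ.frob_mul (X - V * Qᵀ), Matrix.sub_mul, Matrix.sub_mul,
    Matrix.mul_assoc V, hQ.1, Matrix.mul_one] at this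

end Orthogonal

section Blocks

variable {n d : ℕ}

theorem blk_mul {k l : ℕ} (S : Matrix (Fin n × Fin d) (Fin k) ℝ) (B : Matrix (Fin k) (Fin l) ℝ)
    (i : Fin n) : blk (S * B) i = blk S i * B := by
  ext a b
  simp [blk, mul_apply]

theorem blk_ZStack (i : Fin n) : blk (ZStack n d) i = 1 := by
  ext a b
  simp [blk, ZStack, one_apply]

theorem frob_sq_eq_sum_blk {k : ℕ} (S : Matrix (Fin n × Fin d) (Fin k) ℝ) :
    frob S ^ 2 = ∑ i, frob (blk S i) ^ 2 := by
  simp only [frob_sq, Fintype.sum_prod_type, blk, of_apply]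

theorem orthBlocks_ZStack : OrthBlocks (ZStack n d) := fun i => by
  rw [blk_ZStack]
  exact IsOrth.one

theorem OrthBlocks.mul_isOrth {S : Matrix (Fin n × Fin d) (Fin d) ℝ} (hS : OrthBlocks S)
    {Q : Matrix (Fin d) (Fin d) ℝ} (hQ : IsOrth Q) : OrthBlocks (S * Q) := fun i => by
  rw [blk_mul]
  exact (hS i).mul hQ

theorem OrthBlocks.transpose_mul_self {S : Matrix (Fin n × Fin d) (Fin d) ℝ}
    (hS : OrthBlocks S) : Sᵀ * S = (n : ℝ) • 1 := by
  ext a b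
  have h : ∀ i, ∑ c, S (i, c) a * S (i, c) b = (1 : Matrix (Fin d) (Fin d) ℝ) a b := fun i =>
    congrFun (congrFun (hS i).1 a) b
  simp [mul_apply, Fintype.sum_prod_type, h]

theorem OrthBlocks.vnorm_mulVec {S : Matrix (Fin n × Fin d) (Fin d) ℝ} (hS : OrthBlocks S)
    (v : Fin d → ℝ) : vnorm (S *ᵥ v) = √n * vnorm v :=
  vnorm_mulVec_of_transpose_mul hS.transpose_mul_self v

theorem OrthBlocks.opNorm_le {S : Matrix (Fin n × Fin d) (Fin d) ℝ} (hS : OrthBlocks S) :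
    opNorm S ≤ √n :=
  GOPP.opNorm_le (Real.sqrt_nonneg _) fun v => (hS.vnorm_mulVec v).le

theorem OrthBlocks.opNorm_transpose_le {S : Matrix (Fin n × Fin d) (Fin d) ℝ}
    (hS : OrthBlocks S) : opNorm Sᵀ ≤ √n :=
  (GOPP.opNorm_transpose_le S).trans hS.opNorm_le

theorem OrthBlocks.frob_mul {k : ℕ} {S : Matrix (Fin n × Fin d) (Fin d) ℝ} (hS : OrthBlocks S)
    (B : Matrix (Fin d) (Fin k) ℝ) : frob (S * B) = √n * frob B := by
  rw [← sq_eq_sq₀ (frob_nonneg _) (mul_nonneg (Real.sqrt_nonneg _) (frob_nonneg _)), mul_pow,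
    frob_sq_eq_sum_col, frob_sq_eq_sum_col, Finset.mul_sum]
  refine Finset.sum_congr rfl fun j _ => ?_
  rw [← mul_pow, ← hS.vnorm_mulVec]
  rfl

theorem dF_nonneg (X Y : Matrix (Fin n × Fin d) (Fin d) ℝ) : 0 ≤ dF X Y :=
  Real.sInf_nonneg (by rintro r ⟨Q, -, rfl⟩; exact frob_nonneg _)

theorem dF_le (X Y : Matrix (Fin n × Fin d) (Fin d) ℝ) {Q : Matrix (Fin d) (Fin d) ℝ}
    (hQ : IsOrth Q) : dF X Y ≤ frob (X - Y * Q) :=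
  csInf_le ⟨0, by rintro r ⟨Q, -, rfl⟩; exact frob_nonneg _⟩ ⟨Q, hQ, rfl⟩

theorem exists_isOrth_frob_lt {X Y : Matrix (Fin n × Fin d) (Fin d) ℝ} {r : ℝ}
    (h : dF X Y < r) :
    ∃ Q : Matrix (Fin d) (Fin d) ℝ, IsOrth Q ∧ frob (X - Y * Q) < r := by
  obtain ⟨_, ⟨Q, hQ, rfl⟩, hr⟩ := exists_lt_of_csInf_lt (α := ℝ) (by exact ⟨_, 1, IsOrth.one, rfl⟩) h
  exact ⟨Q, hQ, hr⟩

theorem le_dF {X Y : Matrix (Fin n × Fin d) (Fin d) ℝ} {r : ℝ}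
    (h : ∀ Q : Matrix (Fin d) (Fin d) ℝ, IsOrth Q → r ≤ frob (X - Y * Q)) : r ≤ dF X Y :=
  le_csInf ⟨_, 1, IsOrth.one, rfl⟩ (by rintro _ ⟨Q, hQ, rfl⟩; exact h Q hQ)

theorem OrthBlocks.vnorm_transpose_mul_mulVec_ge {X Y : Matrix (Fin n × Fin d) (Fin d) ℝ}
    (hY : OrthBlocks Y) {R : Matrix (Fin d) (Fin d) ℝ} (hR : IsOrth R) {ρ : ℝ}
    (h : frob (X - Y * R) ≤ ρ * √n) (v : Fin d → ℝ) :
    n * (1 - ρ) * vnorm v ≤ vnorm ((Yᵀ * X) *ᵥ v) := by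
  have e : (n : ℝ) • (R *ᵥ v) = (Yᵀ * X) *ᵥ v - Yᵀ *ᵥ ((X - Y * R) *ᵥ v) := by
    rw [mulVec_mulVec, ← sub_mulVec, Matrix.mul_sub, ← Matrix.mul_assoc, hY.transpose_mul_self,
      sub_sub_cancel, Matrix.smul_mul, Matrix.one_mul, smul_mulVec]
  have h1 := vnorm_sub_le ((Yᵀ * X) *ᵥ v) (Yᵀ *ᵥ ((X - Y * R) *ᵥ v))
  rw [← e, vnorm_smul, hR.vnorm_mulVec, Nat.abs_cast] at h1
  have h2 : vnorm (Yᵀ *ᵥ ((X - Y * R) *ᵥ v)) ≤ √n * (ρ * √n * vnorm v) := by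
    refine (vnorm_mulVec_le _ _).trans (mul_le_mul hY.opNorm_transpose_le ?_ (vnorm_nonneg _)
      (Real.sqrt_nonneg _))
    exact (vnorm_mulVec_le_frob _ _).trans (mul_le_mul_of_nonneg_right h (vnorm_nonneg _))
  have h3 : √n * (ρ * √n * vnorm v) = n * ρ * vnorm v := by
    linear_combination ρ * vnorm v * Real.mul_self_sqrt (Nat.cast_nonneg (α := ℝ) n)
  linarith

/-- Near `Z`, the optimal alignment `Q` of `Y` to `X` makes `Zᵀ * (X - Y * Q)` of second order. -/
theorem OrthBlocks.exists_alignment (hn : 1 ≤ n) {X Y : Matrix (Fin n × Fin d) (Fin d) ℝ}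
    (hX : OrthBlocks X) (hY : OrthBlocks Y) {Rx Ry : Matrix (Fin d) (Fin d) ℝ}
    (hRx : IsOrth Rx) (hRy : IsOrth Ry) {ρ : ℝ} (hρ : ρ ≤ 1 / 25)
    (hXR : frob (X - ZStack n d * Rx) ≤ ρ * √n) (hYR : frob (Y - ZStack n d * Ry) ≤ ρ * √n) :
    ∃ Q : Matrix (Fin d) (Fin d) ℝ, IsOrth Q ∧ frob (X - Y * Q) = dF X Y ∧
      frob ((ZStack n d)ᵀ * (X - Y * Q)) ≤ 11 / 10 * ρ * √n * dF X Y := by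
  have hn' : (0 : ℝ) < n := by exact_mod_cast hn
  have hr : 0 < √(n : ℝ) := Real.sqrt_pos.2 hn'
  set Z := ZStack n d with hZ
  have hρ0 : 0 ≤ ρ := by
    by_contra! hc
    linarith [frob_nonneg (X - Z * Rx), mul_neg_of_neg_of_pos hc hr]
  have hQ0 : IsOrth (Ryᵀ * Rx) := hRy.transpose.mul hRx
  have h0 : frob (X - Y * (Ryᵀ * Rx)) ≤ 2 * ρ * √n := by
    have e : X - Y * (Ryᵀ * Rx) = (X - Z * Rx) - (Y - Z * Ry) * (Ryᵀ * Rx) := by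
      rw [Matrix.sub_mul, Matrix.mul_assoc Z, ← Matrix.mul_assoc Ry, hRy.2, Matrix.one_mul]
      abel
    rw [e]
    refine (frob_sub_le _ _).trans ?_
    rw [hQ0.frob_mul]
    linarith
  obtain ⟨Q, S, hQ, hS, hQS, hS'⟩ := exists_polar_decomposition (X := Yᵀ * X)
    (δ := n * (1 - 2 * ρ)) (by have : 0 < 1 - 2 * ρ := by linarith
                               positivity) (hY.vnorm_transpose_mul_mulVec_ge hQ0 h0)
  have hmin : ∀ V : Matrix (Fin d) (Fin d) ℝ, IsOrth V → frob (X - Y * Q) ≤ frob (X - Y * V) := by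
    intro V hV
    refine abs_le_of_sq_le_sq' ?_ (frob_nonneg _) |>.2
    rw [frob_sub_sq, frob_sub_sq, hV.frob_mul, hQ.frob_mul, transpose_mul, transpose_mul,
      Matrix.mul_assoc, Matrix.mul_assoc, hQS]
    have h1 := trace_polar_gap hQ hV hS hS'
    have h2 : 0 ≤ n * (1 - 2 * ρ) / 2 * frob (Q - V) ^ 2 :=
      mul_nonneg (div_nonneg (mul_nonneg hn'.le (by linarith)) two_pos.le) (sq_nonneg _)
    linarith
  have hD : frob (X - Y * Q) = dF X Y := le_antisymm (le_dF hmin) (dF_le X Y hQ)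
  refine ⟨Q, hQ, hD, ?_⟩
  rw [← hD]
  set E := X - Y * Q with hE
  have horth : (X + Y * Q)ᵀ * E = 0 := by
    have hQS' : Xᵀ * Y = S * Qᵀ := by
      rw [← hS, ← transpose_mul, ← hQS, transpose_mul, transpose_transpose]
    have e1 : Xᵀ * (Y * Q) = S := by
      rw [← Matrix.mul_assoc, hQS', Matrix.mul_assoc, hQ.1, Matrix.mul_one]
    have e2 : (Y * Q)ᵀ * X = S := by
      rw [transpose_mul, Matrix.mul_assoc, hQS, ← Matrix.mul_assoc, hQ.1, Matrix.one_mul]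
    rw [hE, transpose_add, Matrix.add_mul, Matrix.mul_sub, Matrix.mul_sub, e1, e2,
      hX.transpose_mul_self, (hY.mul_isOrth hQ).transpose_mul_self]
    abel
  have hYQ : frob (Y * Q - Z * (Ry * Q)) ≤ ρ * √n := by
    rwa [← Matrix.mul_assoc, ← Matrix.sub_mul, hQ.frob_mul]
  have hRR : frob (Rx - Ry * Q) ≤ 4 * ρ := by
    have h1 : √n * frob (Rx - Ry * Q) ≤ √n * (4 * ρ) := by
      rw [← orthBlocks_ZStack.frob_mul (n := n), ← hZ]
      have e : Z * (Rx - Ry * Q) = (E - (X - Z * Rx)) + (Y * Q - Z * (Ry * Q)) := by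
        rw [Matrix.mul_sub, hE]
        abel
      have h2 := frob_add_le (E - (X - Z * Rx)) (Y * Q - Z * (Ry * Q))
      have h3 := frob_sub_le E (X - Z * Rx)
      have h4 := (hmin _ hQ0).trans h0
      rw [e]
      linarith
    exact le_of_mul_le_mul_left h1 hr
  have e : (2 : ℝ) • (Rxᵀ * (Zᵀ * E)) =
      (Rx - Ry * Q)ᵀ * (Zᵀ * E) - (X - Z * Rx)ᵀ * E - (Y * Q - Z * (Ry * Q))ᵀ * E := by
    have h1 : (Rx - Ry * Q)ᵀ * (Zᵀ * E) - (X - Z * Rx)ᵀ * E - (Y * Q - Z * (Ry * Q))ᵀ * E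
        = (2 : ℝ) • (Rxᵀ * (Zᵀ * E)) - (X + Y * Q)ᵀ * E := by
      simp only [transpose_sub, transpose_add, Matrix.sub_mul, Matrix.add_mul, two_smul,
        transpose_mul Z, Matrix.mul_assoc]
      abel
    rw [h1, horth, sub_zero]
  have h1 : 2 * frob (Zᵀ * E) ≤ 4 * ρ * frob (Zᵀ * E) + ρ * √n * frob E + ρ * √n * frob E := by
    have h2 : frob ((2 : ℝ) • (Rxᵀ * (Zᵀ * E))) = 2 * frob (Zᵀ * E) := by
      rw [frob_smul, hRx.transpose.mul_frob, abs_two]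
    rw [← h2, e]
    refine (frob_sub_le _ _).trans (add_le_add ((frob_sub_le _ _).trans (add_le_add ?_ ?_)) ?_)
    · exact frob_mul_le_mul ((opNorm_transpose_le_frob _).trans hRR) le_rfl
    · exact frob_mul_le_mul ((opNorm_transpose_le_frob _).trans hXR) le_rfl
    · exact frob_mul_le_mul ((opNorm_transpose_le_frob _).trans hYQ) le_rfl
  have h2 : 0 ≤ ρ * √n * frob E := by
    have := frob_nonneg E
    positivity
  have h3 := mul_le_mul_of_nonneg_right hρ (frob_nonneg (Zᵀ * E))
  linarith

end Blocks

section Operator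

variable {n d m : ℕ}

theorem sigmaMin_mul_vnorm_le {α β : Type*} [Fintype α] [Fintype β] (A : Matrix α β ℝ)
    (v : α → ℝ) : sigmaMin A * vnorm v ≤ vnorm (Aᵀ *ᵥ v) := by
  rcases eq_or_ne (vnorm v) 0 with h | h
  · rw [h, mul_zero]
    exact vnorm_nonneg _
  have hpos := lt_of_le_of_ne (vnorm_nonneg v) h.symm
  have key : sigmaMin A ≤ vnorm (Aᵀ *ᵥ ((vnorm v)⁻¹ • v)) := by
    refine csInf_le ⟨0, ?_⟩ ⟨(vnorm v)⁻¹ • v, ?_, by rw [mulVec_transpose]⟩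
    · rintro r ⟨u, -, rfl⟩
      exact vnorm_nonneg _
    · rw [vnorm_smul, abs_inv, abs_of_pos hpos, inv_mul_cancel₀ h]
  rwa [mulVec_smul, vnorm_smul, abs_inv, abs_of_pos hpos, le_inv_mul_iff₀ hpos, mul_comm] at key

theorem sigmaMin_le_opNorm {α β : Type*} [Fintype α] [Fintype β] [Nonempty α]
    (A : Matrix α β ℝ) : sigmaMin A ≤ opNorm A := by
  classical
  obtain ⟨a⟩ := ‹Nonempty α›
  have h1 : vnorm (Pi.single a (1 : ℝ)) = 1 := by
    rw [← sq_eq_sq₀ (vnorm_nonneg _) zero_le_one, vnorm_sq]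
    simp
  have h2 := (sigmaMin_mul_vnorm_le A (Pi.single a 1)).trans (vnorm_mulVec_le Aᵀ _)
  rw [h1, mul_one, mul_one] at h2
  exact h2.trans (opNorm_transpose_le A)

theorem sigmaMin_sq_mul_vnorm_le {α β : Type*} [Fintype α] [Fintype β] {A : Matrix α β ℝ}
    (hA : 0 ≤ sigmaMin A) (v : α → ℝ) : sigmaMin A ^ 2 * vnorm v ≤ vnorm ((A * Aᵀ) *ᵥ v) := by
  have h1 := pow_le_pow_left₀ (mul_nonneg hA (vnorm_nonneg v)) (sigmaMin_mul_vnorm_le A v) 2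
  rw [vnorm_transpose_mulVec_sq, mulVec_mulVec] at h1
  have h2 := h1.trans (dotProduct_le_vnorm _ _)
  rcases (vnorm_nonneg v).eq_or_lt with h | h
  · rw [← h, mul_zero]
    exact vnorm_nonneg _
  · refine le_of_mul_le_mul_left ?_ h
    linarith

theorem blk_Lop (A : Matrix (Fin d) (Fin m) ℝ) (W : Matrix (Fin n × Fin d) (Fin m) ℝ) (σ : ℝ)
    (S : Matrix (Fin n × Fin d) (Fin d) ℝ) (i : Fin n) :
    blk (Lop A W σ S) i = ((n : ℝ) * opNorm A ^ 2)⁻¹ •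
      (A * Aᵀ * ((ZStack n d)ᵀ * S) + σ • (blk W i * Aᵀ * ((ZStack n d)ᵀ * S) +
        A * (Wᵀ * S) + σ • (blk W i * Wᵀ * S))) := by
  have h1 : Lop A W σ S = ((n : ℝ) * opNorm A ^ 2)⁻¹ •
      (ZStack n d * (A * Aᵀ * ((ZStack n d)ᵀ * S)) + σ • (W * (Aᵀ * ((ZStack n d)ᵀ * S)) +
        ZStack n d * (A * (Wᵀ * S)) + σ • (W * (Wᵀ * S)))) := by
    simp only [Lop, delta, Matrix.add_mul, Matrix.smul_mul, Matrix.mul_assoc]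
  have h2 : ∀ (c : ℝ) (B : Matrix (Fin n × Fin d) (Fin d) ℝ), blk (c • B) i = c • blk B i :=
    fun _ _ => rfl
  have h3 : ∀ B B' : Matrix (Fin n × Fin d) (Fin d) ℝ, blk (B + B') i = blk B i + blk B' i :=
    fun _ _ => rfl
  rw [h1]
  simp only [h2, h3, blk_mul, blk_ZStack, Matrix.one_mul, Matrix.mul_assoc]

theorem vnorm_blk_Lop_mulVec_ge {A : Matrix (Fin d) (Fin m) ℝ} (hA : 0 ≤ sigmaMin A)
    {W : Matrix (Fin n × Fin d) (Fin m) ℝ} {σ : ℝ} (hσ : 0 ≤ σ)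
    {X : Matrix (Fin n × Fin d) (Fin d) ℝ} (hX : OrthBlocks X)
    {R : Matrix (Fin d) (Fin d) ℝ} (hR : IsOrth R) {ρ : ℝ}
    (hXR : frob (X - ZStack n d * R) ≤ ρ * √n) {i : Fin n} {w f : ℝ}
    (hw : opNorm (blk W i * Aᵀ) ≤ w) (hf : frob (blk W i * Wᵀ * X) ≤ f) (v : Fin d → ℝ) :
    ((n : ℝ) * opNorm A ^ 2)⁻¹ * (sigmaMin A ^ 2 * (n * (1 - ρ)) -
      σ * (w * n + opNorm A * opNorm W * √n + σ * f)) * vnorm v ≤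
        vnorm (blk (Lop A W σ X) i *ᵥ v) := by
  have hs : (0 : ℝ) ≤ √n := Real.sqrt_nonneg _
  have hv := vnorm_nonneg v
  rw [blk_Lop, smul_mulVec, vnorm_smul, abs_of_nonneg (by positivity), mul_assoc]
  refine mul_le_mul_of_nonneg_left ?_ (by positivity)
  set Z := ZStack n d
  have hZX : vnorm ((Zᵀ * X) *ᵥ v) ≤ n * vnorm v := by
    rw [← mulVec_mulVec]
    refine (vnorm_mulVec_le _ _).trans ((mul_le_mul_of_nonneg_right
      orthBlocks_ZStack.opNorm_transpose_le (vnorm_nonneg _)).trans_eq ?_)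
    rw [hX.vnorm_mulVec, ← mul_assoc, Real.mul_self_sqrt (Nat.cast_nonneg n)]
  have h1 : sigmaMin A ^ 2 * (n * (1 - ρ) * vnorm v) ≤ vnorm ((A * Aᵀ * (Zᵀ * X)) *ᵥ v) := by
    rw [← mulVec_mulVec _ (A * Aᵀ)]
    exact (mul_le_mul_of_nonneg_left (orthBlocks_ZStack.vnorm_transpose_mul_mulVec_ge hR hXR v)
      (sq_nonneg _)).trans (sigmaMin_sq_mul_vnorm_le hA _)
  have h2 : vnorm ((blk W i * Aᵀ * (Zᵀ * X)) *ᵥ v) ≤ w * (n * vnorm v) := by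
    rw [← mulVec_mulVec _ (blk W i * Aᵀ)]
    exact (vnorm_mulVec_le _ _).trans (mul_le_mul hw hZX (vnorm_nonneg _)
      ((opNorm_nonneg _).trans hw))
  have h3 : vnorm ((A * (Wᵀ * X)) *ᵥ v) ≤ opNorm A * (opNorm W * (√n * vnorm v)) := by
    rw [← mulVec_mulVec, ← mulVec_mulVec]
    refine (vnorm_mulVec_le _ _).trans (mul_le_mul_of_nonneg_left ?_ (opNorm_nonneg _))
    rw [← hX.vnorm_mulVec]
    exact (vnorm_mulVec_le _ _).trans
      (mul_le_mul_of_nonneg_right (opNorm_transpose_le W) (vnorm_nonneg _))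
  have h4 : vnorm ((blk W i * Wᵀ * X) *ᵥ v) ≤ f * vnorm v :=
    (vnorm_mulVec_le_frob _ _).trans (mul_le_mul_of_nonneg_right hf hv)
  set M1 := A * Aᵀ * (Zᵀ * X)
  set M2 := blk W i * Aᵀ * (Zᵀ * X)
  set M3 := A * (Wᵀ * X)
  set M4 := blk W i * Wᵀ * X
  have h5 : vnorm ((σ • (M2 + M3 + σ • M4)) *ᵥ v) ≤
      σ * ((w * n + opNorm A * opNorm W * √n + σ * f) * vnorm v) := by
    rw [smul_mulVec, vnorm_smul, abs_of_nonneg hσ, add_mulVec, add_mulVec, smul_mulVec]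
    refine mul_le_mul_of_nonneg_left ?_ hσ
    have h6 := vnorm_add_le (M2 *ᵥ v + M3 *ᵥ v) (σ • M4 *ᵥ v)
    have h7 := vnorm_add_le (M2 *ᵥ v) (M3 *ᵥ v)
    rw [vnorm_smul, abs_of_nonneg hσ] at h6
    linarith [mul_le_mul_of_nonneg_left h4 hσ]
  have h6 := vnorm_sub_le ((M1 + σ • (M2 + M3 + σ • M4)) *ᵥ v) ((σ • (M2 + M3 + σ • M4)) *ᵥ v)
  rw [← sub_mulVec, add_sub_cancel_right] at h6
  linarith

theorem Lop_sub_mul (A : Matrix (Fin d) (Fin m) ℝ) (W : Matrix (Fin n × Fin d) (Fin m) ℝ)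
    (σ : ℝ) (X Y : Matrix (Fin n × Fin d) (Fin d) ℝ) (Q : Matrix (Fin d) (Fin d) ℝ) :
    Lop A W σ X - Lop A W σ Y * Q = Lop A W σ (X - Y * Q) := by
  simp only [Lop, Matrix.mul_sub, smul_sub, Matrix.smul_mul, Matrix.mul_assoc]

theorem frob_Lop_le (A : Matrix (Fin d) (Fin m) ℝ) (W : Matrix (Fin n × Fin d) (Fin m) ℝ)
    {σ : ℝ} (hσ : 0 ≤ σ) (E : Matrix (Fin n × Fin d) (Fin d) ℝ) :
    frob (Lop A W σ E) ≤ ((n : ℝ) * opNorm A ^ 2)⁻¹ *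
      (√n * opNorm A ^ 2 * frob ((ZStack n d)ᵀ * E) +
        σ * (2 * opNorm W * opNorm A * √n + σ * opNorm W ^ 2) * frob E) := by
  have h1 : Lop A W σ E = ((n : ℝ) * opNorm A ^ 2)⁻¹ •
      (ZStack n d * (A * (Aᵀ * ((ZStack n d)ᵀ * E))) + σ • (W * (Aᵀ * ((ZStack n d)ᵀ * E)) +
        ZStack n d * (A * (Wᵀ * E)) + σ • (W * (Wᵀ * E)))) := by
    simp only [Lop, delta, Matrix.add_mul, Matrix.smul_mul, Matrix.mul_assoc]
  have hZ := orthBlocks_ZStack (n := n) (d := d)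
  set Z := ZStack n d
  have ha := opNorm_nonneg A
  have hw := opNorm_nonneg W
  have hs : (0 : ℝ) ≤ √n := Real.sqrt_nonneg _
  have hA' := opNorm_transpose_le A
  have hW' := opNorm_transpose_le W
  have t1 : frob (Z * (A * (Aᵀ * (Zᵀ * E)))) ≤ _ :=
    frob_mul_le_mul hZ.opNorm_le (frob_mul_le_mul le_rfl (frob_mul_le_mul hA' le_rfl))
  have t2 : frob (W * (Aᵀ * (Zᵀ * E))) ≤ _ :=
    frob_mul_le_mul le_rfl (frob_mul_le_mul hA' (frob_mul_le_mul hZ.opNorm_transpose_le le_rfl))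
  have t3 : frob (Z * (A * (Wᵀ * E))) ≤ _ :=
    frob_mul_le_mul hZ.opNorm_le (frob_mul_le_mul le_rfl (frob_mul_le_mul hW' le_rfl))
  have t4 : frob (W * (Wᵀ * E)) ≤ _ := frob_mul_le_mul le_rfl (frob_mul_le_mul hW' le_rfl)
  rw [h1, frob_smul, abs_of_nonneg (by positivity)]
  refine mul_le_mul_of_nonneg_left ?_ (by positivity)
  refine (frob_add_le _ _).trans ?_
  have t5 := frob_add_le (W * (Aᵀ * (Zᵀ * E)) + Z * (A * (Wᵀ * E))) (σ • (W * (Wᵀ * E)))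
  have t6 := frob_add_le (W * (Aᵀ * (Zᵀ * E))) (Z * (A * (Wᵀ * E)))
  rw [frob_smul, abs_of_nonneg hσ] at t5
  rw [frob_smul σ, abs_of_nonneg hσ]
  have t7 := mul_le_mul_of_nonneg_left t4 hσ
  have t8 := mul_le_mul_of_nonneg_left (t5.trans (add_le_add (t6.trans (add_le_add t2 t3)) t7)) hσ
  linarith

end Operator

theorem IsPolarBlocks.dF_le {n d : ℕ} {X Y TX TY : Matrix (Fin n × Fin d) (Fin d) ℝ}
    (hX : IsPolarBlocks X TX) (hY : IsPolarBlocks Y TY) {δ : ℝ} (hδ : 0 < δ)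
    (hX' : ∀ i v, δ * vnorm v ≤ vnorm (blk X i *ᵥ v))
    (hY' : ∀ i v, δ * vnorm v ≤ vnorm (blk Y i *ᵥ v))
    {Q : Matrix (Fin d) (Fin d) ℝ} (hQ : IsOrth Q) :
    δ * dF TX TY ≤ frob (X - Y * Q) := by
  refine (mul_le_mul_of_nonneg_left (GOPP.dF_le TX TY hQ) hδ.le).trans ?_
  refine abs_le_of_sq_le_sq' ?_ (frob_nonneg _) |>.2
  rw [mul_pow, frob_sq_eq_sum_blk, frob_sq_eq_sum_blk, Finset.mul_sum]
  refine Finset.sum_le_sum fun i _ => ?_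
  have e : ∀ B B' : Matrix (Fin n × Fin d) (Fin d) ℝ,
      blk (B - B' * Q) i = blk B i - blk B' i * Q := fun B B' => by
    rw [← blk_mul]
    rfl
  rw [e, e, ← mul_pow]
  refine pow_le_pow_left₀ (mul_nonneg hδ.le (frob_nonneg _)) ?_ 2
  refine (hX i).frob_sub_le ((hY i).mul_isOrth hQ) hδ (hX' i) fun v => ?_
  rw [← mulVec_mulVec, ← hQ.vnorm_mulVec v]
  exact hY' i _

theorem noise_bounds {n d m : ℕ} (hn : 1 ≤ n) (hd : 1 ≤ d) {γ σ s k a b : ℝ} (hs : 0 < s)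
    (hk : 1 ≤ k) (ha : a = k * s) (hσ : 0 < σ) (hb : b ≤ bnd2 n d m γ)
    (h : σ ≤ 1 / 100 * (s / k ^ 2) * √n / (√d * bnd1 n d m γ)) :
    σ * ((2 * √d + √(2 * γ * Real.log n)) * a) ≤ 2 / 100 * s ^ 2 ∧
      σ * (a * b * √n) ≤ 1 / 100 * s ^ 2 * n ∧
      σ * (σ * (6 * √d * bnd1 n d m γ ^ 2)) ≤ 6 / 10000 * s ^ 2 * n ∧
      k ^ 2 * (σ * b / (√n * a)) ≤ 1 / 100 := by
  have hn' : (1 : ℝ) ≤ n := by exact_mod_cast hn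
  have hq : 1 ≤ √(d : ℝ) := Real.one_le_sqrt.2 (by exact_mod_cast hd)
  have hr : 1 ≤ √(n : ℝ) := Real.one_le_sqrt.2 hn'
  have hrr : √(n : ℝ) * √n = n := Real.mul_self_sqrt (by linarith)
  have hB1 : bnd1 n d m γ = √n * √d + √m + √n * √(2 * γ * Real.log n) := by
    rw [bnd1, Real.sqrt_mul (by linarith), show 2 * γ * n * Real.log n = n * (2 * γ * Real.log n)
      by ring, Real.sqrt_mul (by linarith)]
  have hB2 : bnd2 n d m γ = √n * √d + √m + √(2 * γ * Real.log n) := by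
    rw [bnd2, Real.sqrt_mul (by linarith)]
  have hm : 0 ≤ √(m : ℝ) := Real.sqrt_nonneg _
  have ht : 0 ≤ √(2 * γ * Real.log n) := Real.sqrt_nonneg _
  set t := √(2 * γ * Real.log n)
  set B := bnd1 n d m γ
  set q := √(d : ℝ)
  set r := √(n : ℝ)
  have hrt : 0 ≤ (r - 1) * t := mul_nonneg (by linarith) ht
  have hbB : b ≤ B := by linarith
  have hqt : r * (q + t) ≤ B := by linarith
  have hB : 0 < B := lt_of_lt_of_le (by positivity) hqt
  have hk0 : 0 < k := by linarith
  have hr0 : 0 < r := by linarith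
  have hq0 : 0 < q := by linarith
  have H : σ * B ≤ 1 / 100 * s * r / (k ^ 2 * q) := by
    rw [le_div_iff₀ (by positivity)] at h ⊢
    calc σ * B * (k ^ 2 * q) = σ * (q * B) * k ^ 2 := by ring
      _ ≤ 1 / 100 * (s / k ^ 2) * r * k ^ 2 := by gcongr
      _ = _ := by field_simp
  have H' : σ * B * k ^ 2 ≤ 1 / 100 * s * r := by
    rw [le_div_iff₀ (by positivity)] at H
    refine le_trans ?_ H
    have : 0 ≤ σ * B * k ^ 2 * (q - 1) := mul_nonneg (by positivity) (by linarith)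
    linarith
  have H1 : σ * B * k ≤ 1 / 100 * s * r := by
    have : 0 ≤ σ * B * k * (k - 1) := mul_nonneg (by positivity) (by linarith)
    linarith
  have H0 : σ * B ≤ 1 / 100 * s * r := by
    have : 0 ≤ σ * B * (k - 1) := mul_nonneg (by positivity) (by linarith)
    linarith
  have H2 : σ * B * q ≤ 1 / 100 * s * r := by
    rw [le_div_iff₀ (by positivity)] at H
    have : 0 ≤ σ * B * q * (k ^ 2 - 1) :=
      mul_nonneg (by positivity) (by linarith [one_le_pow₀ (n := 2) hk])
    linarith
  refine ⟨?_, ?_, ?_, ?_⟩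
  · refine le_of_mul_le_mul_left ?_ hr0
    calc r * (σ * ((2 * q + t) * a)) ≤ 2 * (σ * (r * (q + t)) * k) * s := by
          rw [ha]
          have : 0 ≤ r * σ * t * (k * s) := by positivity
          linarith
      _ ≤ 2 * (σ * B * k) * s := by gcongr
      _ ≤ 2 * (1 / 100 * s * r) * s := by gcongr
      _ = _ := by ring
  · calc σ * (a * b * r) ≤ σ * (a * B * r) := by rw [ha]; gcongr
      _ = (σ * B * k) * (s * r) := by rw [ha]; ring
      _ ≤ (1 / 100 * s * r) * (s * r) := by gcongr
      _ = _ := by rw [← hrr]; ring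
  · calc σ * (σ * (6 * q * B ^ 2)) = 6 * ((σ * B * q) * (σ * B)) := by ring
      _ ≤ 6 * ((1 / 100 * s * r) * (1 / 100 * s * r)) := by gcongr
      _ = _ := by rw [← hrr]; ring
  · have hra : 0 < r * a := by rw [ha]; positivity
    rw [← mul_div_assoc, div_le_iff₀ hra]
    calc k ^ 2 * (σ * b) ≤ k ^ 2 * (σ * B) := by gcongr
      _ = σ * B * k ^ 2 := by ring
      _ ≤ 1 / 100 * s * r := H'
      _ ≤ 1 / 100 * (r * a) := by
        rw [ha]
        have : 0 ≤ r * s * (k - 1) := mul_nonneg (by positivity) (by linarith)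
        linarith

theorem exists_isOrth_frob_sub_ZStack_le {n d : ℕ} (hn : 1 ≤ n) (hd : 1 ≤ d) {ε : ℝ}
    (hε : 0 < ε) {X : Matrix (Fin n × Fin d) (Fin d) ℝ} (hX : memNeps ε X) :
    ∃ R : Matrix (Fin d) (Fin d) ℝ, IsOrth R ∧
      frob (X - ZStack n d * R) ≤ 11 / 10 * (ε * √d) * √n := by
  have hn' : (0 : ℝ) < n := by exact_mod_cast hn
  have hd' : (0 : ℝ) < d := by exact_mod_cast hd
  have h : 0 < ε * √(n * d : ℝ) := by positivity
  obtain ⟨R, hR, h1⟩ := exists_isOrth_frob_lt (r := 11 / 10 * (ε * √(n * d : ℝ)))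
    (hX.2.trans_lt (by linarith))
  refine ⟨R, hR, h1.le.trans_eq ?_⟩
  rw [Real.sqrt_mul hn'.le]
  ring

/-- Proposition 5.5, contraction part: T = P_n ∘ L contracts d_F on
N_ε ∩ N_{ξ,∞} with factor (κ²/(1−ε²d))(2ε√d + 3σ‖W‖/(√n‖A‖)) ≤ 1/2. -/
theorem T_contraction :
    ∃ c : ℝ, 0 < c ∧
      ∀ (n d m : ℕ), 1 ≤ n → 1 ≤ d → d ≤ m →
      ∀ A : Matrix (Fin d) (Fin m) ℝ, 0 < sigmaMin A →
      ∀ W : Matrix (Fin n × Fin d) (Fin m) ℝ, ∀ σ γ : ℝ, 0 < σ → 2 ≤ γ →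
      opNorm W ≤ bnd2 n d m γ →
      (∀ i, opNorm (blk W i * Aᵀ) ≤
        (2 * Real.sqrt (d : ℝ) + Real.sqrt (2 * γ * Real.log n)) * opNorm A) →
      ∀ ε ξ : ℝ, ε = 1 / (32 * kappa A ^ 2 * Real.sqrt (d : ℝ)) → ξ = 6 →
      σ ≤ c * (sigmaMin A / kappa A ^ 2) * Real.sqrt (n : ℝ) /
        (Real.sqrt (d : ℝ) * bnd1 n d m γ) →
      ∀ X Y : Matrix (Fin n × Fin d) (Fin d) ℝ,
        memNeps ε X → memNxi W γ ξ X → memNeps ε Y → memNxi W γ ξ Y →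
      ∀ TX TY, IsPolarBlocks (Lop A W σ X) TX → IsPolarBlocks (Lop A W σ Y) TY →
        dF TX TY ≤ kappa A ^ 2 / (1 - ε ^ 2 * (d : ℝ)) *
          (2 * ε * Real.sqrt (d : ℝ) +
            3 * σ * opNorm W / (Real.sqrt (n : ℝ) * opNorm A)) * dF X Y ∧
        kappa A ^ 2 / (1 - ε ^ 2 * (d : ℝ)) *
          (2 * ε * Real.sqrt (d : ℝ) +
            3 * σ * opNorm W / (Real.sqrt (n : ℝ) * opNorm A)) * dF X Y ≤
          1 / 2 * dF X Y := by
  refine ⟨1 / 100, by norm_num, ?_⟩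
  intro n d m hn hd _ A hA W σ γ hσ _ hW hWA ε ξ hε hξ hσle X Y hXε hXξ hYε hYξ TX TY hTX hTY
  subst hξ
  have : Nonempty (Fin d) := ⟨⟨0, hd⟩⟩
  have hn' : (0 : ℝ) < n := by exact_mod_cast hn
  have hr : 0 < √(n : ℝ) := Real.sqrt_pos.2 hn'
  have hrr : √(n : ℝ) * √n = n := Real.mul_self_sqrt hn'.le
  have hq : 0 < √(d : ℝ) := Real.sqrt_pos.2 (by exact_mod_cast hd)
  have hsa : sigmaMin A ≤ opNorm A := sigmaMin_le_opNorm A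
  have ha : 0 < opNorm A := hA.trans_le hsa
  have hk : 1 ≤ kappa A := (one_le_div hA).2 hsa
  have hka : opNorm A = kappa A * sigmaMin A := (div_mul_cancel₀ _ hA.ne').symm
  have hk2 : 1 ≤ kappa A ^ 2 := one_le_pow₀ hk
  have hε0 : 0 < ε := by
    rw [hε]
    positivity
  have hεq : kappa A ^ 2 * (ε * √d) = 1 / 32 := by
    rw [hε]
    field_simp
  obtain ⟨N1, N2, N3, N4⟩ := noise_bounds hn hd hA hk hka hσ hW hσle
  obtain ⟨Rx, hRx, hXR⟩ := exists_isOrth_frob_sub_ZStack_le hn hd hε0 hXε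
  obtain ⟨Ry, hRy, hYR⟩ := exists_isOrth_frob_sub_ZStack_le hn hd hε0 hYε
  have hη : ε * √d ≤ 1 / 32 := by
    rw [← hεq]
    exact le_mul_of_one_le_left (by positivity) hk2
  have hεd : ε ^ 2 * d = (ε * √d) ^ 2 := by
    rw [mul_pow, Real.sq_sqrt (Nat.cast_nonneg d)]
  have hη0 : 0 < ε * √d := by positivity
  have hνe : 3 * σ * opNorm W / (√n * opNorm A) = 3 * (σ * opNorm W / (√n * opNorm A)) := by ring
  have hηe : 2 * ε * √d = 2 * (ε * √d) := by ring
  have hν0 : 0 ≤ σ * opNorm W / (√n * opNorm A) := by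
    have := opNorm_nonneg W
    positivity
  have hν : σ * opNorm W / (√n * opNorm A) ≤ 1 / 100 :=
    (le_mul_of_one_le_left hν0 hk2).trans N4
  rw [hεd, hνe, hηe]
  set η := ε * √(d : ℝ)
  have hη2 : η ^ 2 ≤ 1 / 1024 := (pow_le_pow_left₀ hη0.le hη 2).trans (by norm_num)
  have hD := dF_nonneg X Y
  set κ := kappa A
  have hκ0 : 0 < κ := by linarith
  have lower : ∀ {S : Matrix (Fin n × Fin d) (Fin d) ℝ} {R : Matrix (Fin d) (Fin d) ℝ},
      memNxi W γ 6 S → IsOrth R → frob (S - ZStack n d * R) ≤ 11 / 10 * η * √n →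
      ∀ i v, 9 / 10 / κ ^ 2 * vnorm v ≤ vnorm (blk (Lop A W σ S) i *ᵥ v) := by
    intro S R hS hR hSR i v
    refine le_trans (mul_le_mul_of_nonneg_right ?_ (vnorm_nonneg v))
      (vnorm_blk_Lop_mulVec_ge hA.le hσ.le hS.1 hR hSR (hWA i) (hS.2 i) v)
    have e : 9 / 10 / κ ^ 2 = (n * opNorm A ^ 2)⁻¹ * (9 / 10 * (sigmaMin A ^ 2 * n)) := by
      rw [hka]
      field_simp
    rw [e]
    refine mul_le_mul_of_nonneg_left ?_ (by positivity)
    have h1 := mul_le_mul_of_nonneg_right N1 hn'.le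
    have h2 : 0 ≤ sigmaMin A ^ 2 * n * (1 / 32 - η) :=
      mul_nonneg (by positivity) (by linarith)
    have h3 : 0 ≤ sigmaMin A ^ 2 * n := by positivity
    linarith
  obtain ⟨Q, hQ, hQD, hZQ⟩ := hXε.1.exists_alignment hn hYε.1 hRx hRy
    (by linarith : 11 / 10 * η ≤ 1 / 25) hXR hYR
  have hdF := IsPolarBlocks.dF_le hTX hTY (by positivity) (lower hXξ hRx hXR)
    (lower hYξ hRy hYR) hQ
  have hL := frob_Lop_le A W hσ.le (X - Y * Q)
  rw [← Lop_sub_mul] at hL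
  rw [hQD] at hL
  set ν := σ * opNorm W / (√n * opNorm A) with hνdef
  have hσw : σ * opNorm W = ν * (√n * opNorm A) := by
    rw [hνdef]
    field_simp
  have hL' : frob (Lop A W σ X - Lop A W σ Y * Q) ≤ (121 / 100 * η + 2 * ν + ν ^ 2) * dF X Y := by
    refine hL.trans ?_
    have e1 : σ * (2 * opNorm W * opNorm A * √n + σ * opNorm W ^ 2) =
        n * opNorm A ^ 2 * (2 * ν + ν ^ 2) := by
      calc _ = 2 * (σ * opNorm W) * opNorm A * √n + (σ * opNorm W) ^ 2 := by ring
        _ = √n * √n * opNorm A ^ 2 * (2 * ν + ν ^ 2) := by rw [hσw]; ring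
        _ = _ := by rw [hrr]
    have e2 : √n * opNorm A ^ 2 * frob ((ZStack n d)ᵀ * (X - Y * Q)) ≤
        n * opNorm A ^ 2 * (121 / 100 * η * dF X Y) := by
      refine (mul_le_mul_of_nonneg_left hZQ (by positivity)).trans_eq ?_
      linear_combination 121 / 100 * opNorm A ^ 2 * η * dF X Y * hrr
    rw [inv_mul_le_iff₀ (by positivity), e1]
    linarith
  have hfac : 1 ≤ 1 / (1 - η ^ 2) := by
    rw [le_div_iff₀ (by linarith)]
    linarith [sq_nonneg η]
  constructor
  · have h1 := hdF.trans hL'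
    rw [div_mul_eq_mul_div, div_le_iff₀ (by positivity)] at h1
    have h2 : 121 / 100 * η + 2 * ν + ν ^ 2 ≤ 9 / 10 * (2 * η + 3 * ν) := by
      have : 0 ≤ ν * (1 / 100 - ν) := mul_nonneg hν0 (by linarith)
      linarith
    have h3 : (121 / 100 * η + 2 * ν + ν ^ 2) * dF X Y * κ ^ 2 ≤
        9 / 10 * (2 * η + 3 * ν) * dF X Y * κ ^ 2 := by gcongr
    have h4 : 0 ≤ κ ^ 2 * (2 * η + 3 * ν) * dF X Y := by positivity
    have h5 := mul_le_mul_of_nonneg_right hfac h4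
    calc dF TX TY ≤ κ ^ 2 * (2 * η + 3 * ν) * dF X Y := by linarith
      _ ≤ 1 / (1 - η ^ 2) * (κ ^ 2 * (2 * η + 3 * ν) * dF X Y) := by linarith
      _ = _ := by ring
  · refine mul_le_mul_of_nonneg_right ?_ hD
    rw [div_mul_eq_mul_div, div_le_iff₀ (by linarith)]
    linarith

end GOPP
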